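/- Let n ≥ 1 be a natural number, t > 0 a real number, and let U₁ and U₂ be nonempty bounded measurable subsets of Euclidean space ℝⁿ. Then ∫_{U₁} ∫_{U₂} (4πt)^{-n/2} exp(-‖x−y‖²/(4t)) dy dx ≤ vol(U₁)^{1/2} · vol(U₂)^{1/2} · exp(-d(U₁,U₂)²/(4t)). -/

import Mathlib

open MeasureTheory Real
open scoped FourierTransform SchwartzMap ContDiff

theorem planch_ae {n : ℕ} (g : EuclideanSpace ℝ (Fin n) → ℂ) (h1 : Integrable g)
    (h2 : MemLp g 2) : (𝓕 (h2.toLp g) : Lp (α := EuclideanSpace ℝ (Fin n)) ℂ 2) =ᵐ[volume] 𝓕 g := by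
  have hcont : Continuous (𝓕 g) :=
    VectorFourier.fourierIntegral_continuous Real.continuous_fourierChar
      (by exact continuous_inner) h1
  refine ae_eq_of_integral_contDiff_smul_eq (μ := volume) ?_ hcont.locallyIntegrable ?_
  · exact (Lp.memLp _).locallyIntegrable (by norm_num)
  intro φ hφ hφc
  have hc : HasCompactSupport (fun x => (φ x : ℂ)) := hφc.comp_left Complex.ofReal_zero
  let ψ : 𝓢(EuclideanSpace ℝ (Fin n), ℂ) := hc.toSchwartzMap (Complex.ofRealCLM.contDiff.comp hφ)
  have key := congrArg (fun T : 𝓢'(EuclideanSpace ℝ (Fin n), ℂ) => T ψ) (Lp.fourier_toTemperedDistribution_eq (h2.toLp g))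
  simp only [TemperedDistribution.fourier_apply, MeasureTheory.Lp.toTemperedDistribution_apply (E := EuclideanSpace ℝ (Fin n)) (μ := volume)] at key
  have e1 : ∫ x, φ x • (𝓕 (h2.toLp g) : Lp ℂ 2 (volume : Measure (EuclideanSpace ℝ (Fin n)))) x
      = ∫ x, (𝓕 ψ) x • g x := by
    have e2 : (∫ x, (𝓕 ψ) x • g x) = ∫ x, (𝓕 ψ) x • (h2.toLp g) x := by
      apply integral_congr_ae
      filter_upwards [h2.coeFn_toLp] with x hx
      rw [hx]
    rw [e2, key]
    rfl
  rw [e1]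
  have := VectorFourier.integral_fourierIntegral_smul_eq_flip (μ := volume) (ν := volume)
    (L := innerₗ (EuclideanSpace ℝ (Fin n))) (f := ψ) (g := g)
    Real.continuous_fourierChar (by exact continuous_inner) ψ.integrable h1
  rw [flip_innerₗ] at this
  exact this

theorem planch {n : ℕ} (g : EuclideanSpace ℝ (Fin n) → ℂ) (h1 : Integrable g)
    (h2 : MemLp g 2) : MemLp (𝓕 g) 2 ∧ eLpNorm (𝓕 g) 2 = eLpNorm g 2 := by
  have h := planch_ae g h1 h2
  refine ⟨(memLp_congr_ae h).1 (Lp.memLp _), ?_⟩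
  rw [← eLpNorm_congr_ae h, ← Lp.enorm_toLp h2, ← Lp.enorm_def]
  have := Lp.norm_fourier_eq (h2.toLp g)
  rw [← ofReal_norm, ← ofReal_norm, this]

theorem planch_int {n : ℕ} (g : EuclideanSpace ℝ (Fin n) → ℂ) (h1 : Integrable g)
    (h2 : MemLp g 2) : Integrable (fun x => ‖𝓕 g x‖ ^ (2:ℝ)) ∧
      ∫ x, ‖𝓕 g x‖ ^ (2:ℝ) = ∫ x, ‖g x‖ ^ (2:ℝ) := by
  obtain ⟨h3, h4⟩ := planch g h1 h2
  constructor
  · have := h3.integrable_norm_rpow (by norm_num) (by norm_num)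
    simpa using this
  · rw [h3.eLpNorm_eq_integral_rpow_norm (by norm_num) (by norm_num),
      h2.eLpNorm_eq_integral_rpow_norm (by norm_num) (by norm_num),
      ENNReal.ofReal_eq_ofReal_iff (by positivity) (by positivity)] at h4
    have h5 := (Real.rpow_left_inj (by positivity) (by positivity) (by norm_num)).1 h4
    simpa using h5

theorem cs_bound {n : ℕ} (g : EuclideanSpace ℝ (Fin n) → ℂ) (h1 : Integrable g)
    (h2 : MemLp g 2) (a : ℝ) (ha : a ≠ 0) (U : Set (EuclideanSpace ℝ (Fin n)))
    (hU : volume U ≠ ⊤) :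
    |a| ^ ((n : ℝ) / 2) * ∫ x in U, ‖𝓕 g (a • x)‖
      ≤ (volume U).toReal ^ ((1:ℝ)/2) * (∫ x, ‖g x‖ ^ (2:ℝ)) ^ ((1:ℝ)/2) := by
  obtain ⟨h3, h4⟩ := planch_int g h1 h2
  have hcont : Continuous (𝓕 g) :=
    VectorFourier.fourierIntegral_continuous Real.continuous_fourierChar
      (by exact continuous_inner) h1
  have hI : Integrable (fun x => ‖𝓕 g (a • x)‖ ^ (2:ℝ)) := h3.comp_smul ha
  have : IsFiniteMeasure (volume.restrict U) := ⟨by simpa using hU.lt_top⟩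
  have hc2 : Continuous (fun x => ‖𝓕 g (a • x)‖) := by fun_prop
  have hM : MemLp (fun x => ‖𝓕 g (a • x)‖) 2 (volume.restrict U) := by
    have := (integrable_norm_rpow_iff (p := 2) (μ := volume.restrict U)
      hc2.aestronglyMeasurable (by norm_num) (by norm_num)).1
    apply this
    simpa [IntegrableOn] using hI.integrableOn (s := U)
  have cs := integral_mul_le_Lp_mul_Lq_of_nonneg (μ := volume.restrict U) (p := 2) (q := 2)
    Real.HolderConjugate.two_two (f := fun _ => 1) (g := fun x => ‖𝓕 g (a • x)‖)
    (by filter_upwards with x; simp) (by filter_upwards with x; simp)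
    (memLp_const 1) (by simpa using hM)
  simp only [one_mul, Real.one_rpow, integral_const, smul_eq_mul, mul_one] at cs
  have hle : ∫ x in U, ‖𝓕 g (a • x)‖ ^ (2:ℝ) ≤ (|a| ^ n)⁻¹ * ∫ x, ‖g x‖ ^ (2:ℝ) := by
    refine (setIntegral_le_integral hI (by filter_upwards with x; positivity)).trans_eq ?_
    rw [Measure.integral_comp_smul volume (fun x => ‖𝓕 g x‖ ^ (2:ℝ)) a, h4]
    simp [abs_inv, abs_pow]
  have ha' : 0 < |a| := abs_pos.2 ha
  have hr : (volume.restrict U).real Set.univ = (volume U).toReal := by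
    simp [Measure.real]
  rw [hr] at cs
  have h6 : (|a| ^ ((n:ℝ)/2)) = (|a| ^ n) ^ ((1:ℝ)/2) := by
    rw [← Real.rpow_natCast, ← Real.rpow_mul ha'.le]; congr 1; ring
  calc _ ≤ |a| ^ ((n : ℝ) / 2) * ((volume U).toReal ^ ((1:ℝ)/2) *
        ((|a| ^ n)⁻¹ * ∫ x, ‖g x‖ ^ (2:ℝ)) ^ ((1:ℝ)/2)) := by
        gcongr
        exact cs.trans (by gcongr)
    _ = _ := by
        rw [Real.mul_rpow (by positivity) (by positivity), Real.inv_rpow (by positivity), h6]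
        field_simp

theorem imag_bound {n : ℕ} (hn : 1 ≤ n) (c : ℝ)
    (U₁ U₂ : Set (EuclideanSpace ℝ (Fin n)))
    (hf₁ : volume U₁ ≠ ⊤) (hf₂ : volume U₂ ≠ ⊤) (hm₂ : MeasurableSet U₂) (τ : ℝ) :
    ‖((τ * Complex.I) / (4 * π : ℝ)) ^ (((n:ℝ)/2 : ℝ) : ℂ) *
      ProbabilityTheory.complexMGF
        (fun p : EuclideanSpace ℝ (Fin n) × EuclideanSpace ℝ (Fin n) => (c - ‖p.1 - p.2‖ ^ 2) / 4)
        ((volume.restrict U₁).prod (volume.restrict U₂)) (τ * Complex.I)‖ ≤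
      (volume U₁).toReal ^ ((1:ℝ)/2) * (volume U₂).toReal ^ ((1:ℝ)/2) := by
  have hn' : (0:ℝ) < n := by exact_mod_cast hn
  rcases eq_or_ne τ 0 with rfl | hτ
  · have : (((n:ℝ)/2 : ℝ) : ℂ) ≠ 0 := by
      rw [Complex.ofReal_ne_zero]; positivity
    rw [Complex.ofReal_zero, zero_mul, zero_div, Complex.zero_cpow this, zero_mul, norm_zero]
    positivity
  have i1 : IsFiniteMeasure (volume.restrict U₁) := ⟨by simpa using hf₁.lt_top⟩
  have i2 : IsFiniteMeasure (volume.restrict U₂) := ⟨by simpa using hf₂.lt_top⟩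
  set a : ℝ := -τ / (4 * π) with ha
  have ha0 : a ≠ 0 := by
    rw [ha]; exact div_ne_zero (neg_ne_zero.2 hτ) (by positivity)
  set g : EuclideanSpace ℝ (Fin n) → ℂ :=
    U₂.indicator (fun y => Complex.exp (((-τ * ‖y‖ ^ 2 / 4 : ℝ) : ℂ) * Complex.I)) with hg
  have hgc : Continuous (fun y : EuclideanSpace ℝ (Fin n) =>
      Complex.exp (((-τ * ‖y‖ ^ 2 / 4 : ℝ) : ℂ) * Complex.I)) := by fun_prop
  have hgM : ∀ p, MemLp g p := by
    intro p
    rw [hg, memLp_indicator_iff_restrict hm₂]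
    refine MemLp.of_bound hgc.aestronglyMeasurable 1 ?_
    filter_upwards with y
    rw [Complex.norm_exp_ofReal_mul_I]
  have hg2 : ∫ x, ‖g x‖ ^ (2:ℝ) = (volume U₂).toReal := by
    have : (fun x => ‖g x‖ ^ (2:ℝ)) = U₂.indicator (fun _ => (1:ℝ)) := by
      ext x
      by_cases hx : x ∈ U₂
      · simp only [hg, Set.indicator_of_mem hx, Complex.norm_exp_ofReal_mul_I, Real.one_rpow]
      · simp [hg, hx]
    rw [this, integral_indicator hm₂]
    simp [Measure.real]
  have key := cs_bound g (memLp_one_iff_integrable.1 (hgM 1)) (hgM 2) a ha0 U₁ hf₁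
  rw [hg2] at key
  refine le_trans ?_ key
  rw [norm_mul]
  have hnorm : ‖((τ * Complex.I) / (4 * π : ℝ)) ^ (((n:ℝ)/2 : ℝ) : ℂ)‖ = |a| ^ ((n:ℝ)/2) := by
    rw [Complex.norm_cpow_real, norm_div, norm_mul, Complex.norm_I, Complex.norm_real,
      Complex.norm_real, mul_one, ha, abs_div, abs_neg]
    rfl
  rw [hnorm]
  gcongr
  unfold ProbabilityTheory.complexMGF
  have hint : Integrable (fun p : EuclideanSpace ℝ (Fin n) × EuclideanSpace ℝ (Fin n) =>
      Complex.exp (τ * Complex.I * (((c - ‖p.1 - p.2‖ ^ 2) / 4 : ℝ) : ℂ)))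
      ((volume.restrict U₁).prod (volume.restrict U₂)) := by
    refine Integrable.of_bound (Continuous.aestronglyMeasurable (by fun_prop)) 1 ?_
    filter_upwards with p
    rw [show (τ * Complex.I * (((c - ‖p.1 - p.2‖ ^ 2) / 4 : ℝ) : ℂ)) =
      ((τ * ((c - ‖p.1 - p.2‖ ^ 2) / 4) : ℝ) : ℂ) * Complex.I by push_cast; ring,
      Complex.norm_exp_ofReal_mul_I]
  rw [integral_prod _ hint]
  refine (norm_integral_le_integral_norm _).trans_eq ?_
  congr 1
  ext x
  have hx : ∫ y in U₂, Complex.exp (τ * Complex.I * (((c - ‖x - y‖ ^ 2) / 4 : ℝ) : ℂ)) =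
      Complex.exp (((τ * (c - ‖x‖ ^ 2) / 4 : ℝ) : ℂ) * Complex.I) * 𝓕 g (a • x) := by
    rw [Real.fourier_eq', ← integral_const_mul, ← integral_indicator hm₂]
    congr 1
    ext y
    by_cases hy : y ∈ U₂
    · simp only [hg, Set.indicator_of_mem hy, smul_eq_mul]
      rw [← Complex.exp_add, ← Complex.exp_add]
      congr 1
      rw [norm_sub_sq_real, inner_smul_right, real_inner_comm, ha]
      have : (π : ℂ) ≠ 0 := by exact_mod_cast Real.pi_ne_zero
      push_cast
      field_simp
      ring
    · simp [hg, hy]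
  rw [hx, norm_mul, Complex.norm_exp_ofReal_mul_I, one_mul]

theorem pl_bound {n : ℕ} (hn : 1 ≤ n) (c d : ℝ) (hd : 0 ≤ d) (hcd : c < d ^ 2)
    (U₁ U₂ : Set (EuclideanSpace ℝ (Fin n)))
    (hb₁ : Bornology.IsBounded U₁) (hb₂ : Bornology.IsBounded U₂)
    (hm₁ : MeasurableSet U₁) (hm₂ : MeasurableSet U₂)
    (hdist : ∀ x ∈ U₁, ∀ y ∈ U₂, d ≤ ‖x - y‖) (z : ℂ) (hz : 0 ≤ z.re) :
    ‖(z / (4 * π : ℝ)) ^ (((n:ℝ)/2 : ℝ) : ℂ) *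
      ProbabilityTheory.complexMGF
        (fun p : EuclideanSpace ℝ (Fin n) × EuclideanSpace ℝ (Fin n) => (c - ‖p.1 - p.2‖ ^ 2) / 4)
        ((volume.restrict U₁).prod (volume.restrict U₂)) z‖ ≤
      (volume U₁).toReal ^ ((1:ℝ)/2) * (volume U₂).toReal ^ ((1:ℝ)/2) := by
  have hn' : (0:ℝ) < n := by exact_mod_cast hn
  have hf₁ : volume U₁ ≠ ⊤ := hb₁.measure_lt_top.ne
  have hf₂ : volume U₂ ≠ ⊤ := hb₂.measure_lt_top.ne
  have i1 : IsFiniteMeasure (volume.restrict U₁) := ⟨by simpa using hf₁.lt_top⟩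
  have i2 : IsFiniteMeasure (volume.restrict U₂) := ⟨by simpa using hf₂.lt_top⟩
  set X := (fun p : EuclideanSpace ℝ (Fin n) × EuclideanSpace ℝ (Fin n) =>
    (c - ‖p.1 - p.2‖ ^ 2) / 4) with hX
  set μ := (volume.restrict U₁).prod (volume.restrict U₂) with hμ
  have hXc : Continuous X := by rw [hX]; fun_prop
  have hae : ∀ᵐ p ∂μ, p.1 ∈ U₁ ∧ p.2 ∈ U₂ := by
    rw [hμ, Measure.prod_restrict]
    exact ae_restrict_mem (hm₁.prod hm₂)
  obtain ⟨R₁, hR₁⟩ := hb₁.exists_norm_le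
  obtain ⟨R₂, hR₂⟩ := hb₂.exists_norm_le
  obtain ⟨B, hB0, hB⟩ : ∃ B, 0 ≤ B ∧ ∀ᵐ p ∂μ, |X p| ≤ B := by
    refine ⟨(|c| + (R₁ + R₂) ^ 2) / 4, by positivity, ?_⟩
    filter_upwards [hae] with p hp
    have h1 : ‖p.1 - p.2‖ ≤ R₁ + R₂ := (norm_sub_le _ _).trans (add_le_add (hR₁ _ hp.1) (hR₂ _ hp.2))
    have h2 : ‖p.1 - p.2‖ ^ 2 ≤ (R₁ + R₂) ^ 2 := by gcongr
    have h3 := neg_abs_le c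
    have h4 := le_abs_self c
    have h5 := sq_nonneg ‖p.1 - p.2‖
    simp only [hX]
    rw [abs_le]
    constructor <;> linarith
  have hset : ProbabilityTheory.integrableExpSet X μ = Set.univ := by
    ext s
    simp only [ProbabilityTheory.integrableExpSet, Set.mem_ofPred_eq, Set.mem_univ, iff_true]
    refine Integrable.of_bound (Continuous.aestronglyMeasurable (by fun_prop)) (exp (|s| * B)) ?_
    filter_upwards [hB] with p hp
    rw [Real.norm_eq_abs, abs_of_pos (exp_pos _), exp_le_exp]
    refine (le_abs_self _).trans ?_
    rw [abs_mul]
    gcongr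
  have hdiff : Differentiable ℂ (ProbabilityTheory.complexMGF X μ) := by
    intro w
    exact (ProbabilityTheory.hasDerivAt_complexMGF (by rw [hset]; simp)).differentiableAt
  have hmgf : ∀ (s : ℝ) (b : ℝ), (∀ᵐ p ∂μ, s * X p ≤ b) →
      ProbabilityTheory.mgf X μ s ≤ μ.real Set.univ * exp b := by
    intro s b hb
    have hs : Integrable (fun p => exp (s * X p)) μ := by
      have : s ∈ ProbabilityTheory.integrableExpSet X μ := by rw [hset]; trivial
      exact this
    have := integral_mono_ae hs (integrable_const (exp b))
      (by filter_upwards [hb] with p hp; exact exp_le_exp.2 hp)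
    simpa [ProbabilityTheory.mgf] using this
  have hpi : (0:ℝ) < 4 * π := by positivity
  have hpow : ∀ w : ℂ, ‖(w / (4 * π : ℝ)) ^ (((n:ℝ)/2 : ℝ) : ℂ)‖ = (‖w‖ / (4*π)) ^ ((n:ℝ)/2) := by
    intro w
    rw [Complex.norm_cpow_real, norm_div, Complex.norm_real, Real.norm_of_nonneg hpi.le]
  have hclos : closure {z : ℂ | 0 < z.re} = {z : ℂ | 0 ≤ z.re} := Complex.closure_setOfPred_lt_re 0
  refine PhragmenLindelof.right_half_plane_of_tendsto_zero_on_real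
    (f := fun z : ℂ => (z / (4 * π : ℝ)) ^ (((n:ℝ)/2 : ℝ) : ℂ) *
      ProbabilityTheory.complexMGF X μ z) ?_ ?_ ?_ ?_ hz
  · constructor
    · intro w hw
      refine DifferentiableAt.differentiableWithinAt ?_
      refine DifferentiableAt.mul ?_ hdiff.differentiableAt
      refine DifferentiableAt.cpow_const (by fun_prop) ?_
      left
      rw [Complex.div_ofReal_re]
      exact div_pos hw hpi
    · rw [hclos]
      intro w hw
      refine ContinuousAt.continuousWithinAt ?_
      refine ContinuousAt.mul ?_ hdiff.continuous.continuousAt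
      have h1 : ContinuousAt (fun z : ℂ => z ^ (((n:ℝ)/2 : ℝ) : ℂ)) (w / (4 * π : ℝ)) := by
        apply Complex.continuousAt_cpow_const_of_re_pos
        · left
          rw [Complex.div_ofReal_re]
          exact div_nonneg hw hpi.le
        · rw [Complex.ofReal_re]; positivity
      exact ContinuousAt.comp (f := fun z : ℂ => z / (4 * π : ℝ)) h1 (by fun_prop)
  · refine ⟨1, by norm_num, (n:ℝ)/2 + B, ?_⟩
    refine Asymptotics.IsBigO.of_bound (μ.real Set.univ) ?_
    filter_upwards with w
    rw [norm_mul, hpow, Real.rpow_one, Real.norm_of_nonneg (exp_pos _).le, add_mul, exp_add]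
    have h1 : (‖w‖ / (4*π)) ^ ((n:ℝ)/2) ≤ exp ((n:ℝ)/2 * ‖w‖) := by
      rw [mul_comm ((n:ℝ)/2), exp_mul]
      refine Real.rpow_le_rpow (by positivity) ?_ (by positivity)
      have : ‖w‖ / (4 * π) ≤ ‖w‖ := div_le_self (norm_nonneg _) (by linarith [Real.pi_gt_three])
      linarith [add_one_le_exp ‖w‖]
    have h2 : ‖ProbabilityTheory.complexMGF X μ w‖ ≤ μ.real Set.univ * exp (B * ‖w‖) := by
      refine ProbabilityTheory.norm_complexMGF_le_mgf.trans (hmgf _ _ ?_)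
      filter_upwards [hB] with p hp
      refine (le_abs_self _).trans ?_
      rw [abs_mul, mul_comm]
      refine mul_le_mul hp ?_ (abs_nonneg _) hB0
      exact Complex.abs_re_le_norm w
    calc _ ≤ exp ((n:ℝ)/2 * ‖w‖) * (μ.real Set.univ * exp (B * ‖w‖)) := by gcongr
      _ = _ := by ring
  · set ε := (d ^ 2 - c) / 4 with hε
    have hε0 : 0 < ε := by rw [hε]; linarith
    have hlim : Filter.Tendsto (fun x : ℝ => (4*π) ^ (-((n:ℝ)/2)) * μ.real Set.univ *
        (x ^ ((n:ℝ)/2) * exp (-ε * x))) Filter.atTop (nhds 0) := by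
      have := (tendsto_rpow_mul_exp_neg_mul_atTop_nhds_zero ((n:ℝ)/2) ε hε0).const_mul
        ((4*π) ^ (-((n:ℝ)/2)) * μ.real Set.univ)
      simpa using this
    refine squeeze_zero_norm' ?_ hlim
    filter_upwards [Filter.eventually_ge_atTop 0] with x hx
    rw [norm_mul, hpow, Complex.norm_real, Real.norm_of_nonneg hx,
      Real.div_rpow hx hpi.le, Real.rpow_neg hpi.le]
    have h2 : ‖ProbabilityTheory.complexMGF X μ x‖ ≤ μ.real Set.univ * exp (-ε * x) := by
      refine ProbabilityTheory.norm_complexMGF_le_mgf.trans (hmgf _ _ ?_)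
      filter_upwards [hae] with p hp
      have h1 := hdist _ hp.1 _ hp.2
      have h3 : d ^ 2 ≤ ‖p.1 - p.2‖ ^ 2 := by gcongr
      have h4 : X p ≤ -ε := by simp only [hX, hε]; linarith
      rw [Complex.ofReal_re, mul_comm]
      gcongr
    calc _ ≤ x ^ ((n:ℝ)/2) / (4*π) ^ ((n:ℝ)/2) * (μ.real Set.univ * exp (-ε * x)) := by gcongr
      _ = _ := by ring
  · intro τ
    exact imag_bound hn c U₁ U₂ hf₁ hf₂ hm₂ τ

theorem davies_euclidean (n : ℕ) (hn : 1 ≤ n) (t : ℝ) (ht : 0 < t)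
    (U₁ U₂ : Set (EuclideanSpace ℝ (Fin n)))
    (hne₁ : U₁.Nonempty) (hne₂ : U₂.Nonempty)
    (hb₁ : Bornology.IsBounded U₁) (hb₂ : Bornology.IsBounded U₂)
    (hm₁ : MeasurableSet U₁) (hm₂ : MeasurableSet U₂) :
    ∫ x in U₁, ∫ y in U₂,
        (4 * Real.pi * t) ^ (-(n : ℝ) / 2) * Real.exp (-‖x - y‖ ^ 2 / (4 * t))
      ≤ (volume U₁).toReal ^ ((1 : ℝ) / 2) * (volume U₂).toReal ^ ((1 : ℝ) / 2) *
        Real.exp (-(sInf (Set.image2 dist U₁ U₂)) ^ 2 / (4 * t)) := by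
  set d := sInf (Set.image2 dist U₁ U₂) with hd
  have hd0 : 0 ≤ d := by
    apply Real.sInf_nonneg
    rintro _ ⟨x, _, y, _, rfl⟩
    exact dist_nonneg
  have hdist : ∀ x ∈ U₁, ∀ y ∈ U₂, d ≤ ‖x - y‖ := by
    intro x hx y hy
    rw [← dist_eq_norm]
    refine csInf_le ⟨0, ?_⟩ (Set.mem_image2_of_mem hx hy)
    rintro _ ⟨x, _, y, _, rfl⟩
    exact dist_nonneg
  have i1 : IsFiniteMeasure (volume.restrict U₁) := ⟨by simpa using hb₁.measure_lt_top⟩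
  have i2 : IsFiniteMeasure (volume.restrict U₂) := ⟨by simpa using hb₂.measure_lt_top⟩
  have hpi : (0:ℝ) < 4 * π := by positivity
  have main : ∀ c < d ^ 2, ∫ x in U₁, ∫ y in U₂,
        (4 * Real.pi * t) ^ (-(n : ℝ) / 2) * Real.exp (-‖x - y‖ ^ 2 / (4 * t))
      ≤ (volume U₁).toReal ^ ((1 : ℝ) / 2) * (volume U₂).toReal ^ ((1 : ℝ) / 2) *
        Real.exp (-c / (4 * t)) := by
    intro c hc
    have h := pl_bound hn c d hd0 hc U₁ U₂ hb₁ hb₂ hm₁ hm₂ hdist ((t⁻¹ : ℝ) : ℂ)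
      (by rw [Complex.ofReal_re]; positivity)
    rw [norm_mul, Complex.norm_cpow_real, norm_div, Complex.norm_real, Complex.norm_real,
      Real.norm_of_nonneg hpi.le, Real.norm_of_nonneg (by positivity : 0 ≤ t⁻¹),
      ProbabilityTheory.complexMGF_ofReal, Complex.norm_real,
      Real.norm_of_nonneg ProbabilityTheory.mgf_nonneg] at h
    have hint : Integrable (fun p : EuclideanSpace ℝ (Fin n) × EuclideanSpace ℝ (Fin n) =>
        (4 * Real.pi * t) ^ (-(n : ℝ) / 2) * Real.exp (-‖p.1 - p.2‖ ^ 2 / (4 * t)))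
        ((volume.restrict U₁).prod (volume.restrict U₂)) := by
      refine Integrable.const_mul ?_ _
      refine Integrable.of_bound (Continuous.aestronglyMeasurable (by fun_prop)) 1 ?_
      filter_upwards with p
      rw [Real.norm_of_nonneg (exp_pos _).le, exp_le_one_iff]
      have : 0 ≤ ‖p.1 - p.2‖ ^ 2 / (4 * t) := by positivity
      rw [neg_div]; linarith
    rw [← integral_prod _ hint]
    have e : ∫ p, (4 * Real.pi * t) ^ (-(n : ℝ) / 2) * Real.exp (-‖p.1 - p.2‖ ^ 2 / (4 * t))
        ∂((volume.restrict U₁).prod (volume.restrict U₂)) =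
        ((t⁻¹ / (4 * π)) ^ ((n:ℝ)/2) * ProbabilityTheory.mgf
        (fun p : EuclideanSpace ℝ (Fin n) × EuclideanSpace ℝ (Fin n) => (c - ‖p.1 - p.2‖ ^ 2) / 4)
        ((volume.restrict U₁).prod (volume.restrict U₂)) t⁻¹) * exp (-c / (4 * t)) := by
      unfold ProbabilityTheory.mgf
      rw [← integral_const_mul, ← integral_mul_const]
      congr 1
      ext p
      rw [mul_assoc ((t⁻¹ / (4 * π)) ^ ((n:ℝ)/2)), ← exp_add]
      congr 1
      · rw [neg_div, Real.rpow_neg (by positivity), ← Real.inv_rpow (by positivity)]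
        congr 1
        field_simp
      · congr 1
        field_simp
        ring
    rw [e]
    gcongr
  have hcts : Filter.Tendsto (fun c : ℝ => (volume U₁).toReal ^ ((1 : ℝ) / 2) *
      (volume U₂).toReal ^ ((1 : ℝ) / 2) * Real.exp (-c / (4 * t))) (nhdsWithin (d^2) (Set.Iio (d^2)))
      (nhds ((volume U₁).toReal ^ ((1 : ℝ) / 2) *
      (volume U₂).toReal ^ ((1 : ℝ) / 2) * Real.exp (-d^2 / (4 * t)))) :=
    Filter.Tendsto.mono_left (Continuous.tendsto (by fun_prop) _) nhdsWithin_le_nhds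
  refine ge_of_tendsto hcts ?_
  filter_upwards [self_mem_nhdsWithin] with c hc
  exact main c hc
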